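/- De Broglie's geometrization of the quantum Hamilton–Jacobi flow: let U ⊆ ℝ⁴ be open, S : U → ℝ and M : U → ℝ smooth with M > 0 and η^{μν} ∂_μ S ∂_ν S = M² on U, let m₀ > 0 be a constant and ω = log(M/m₀). Let x : I → U be a smooth curve on an open interval I satisfying dx^μ/ds = M(x(s))^{−1} η^{μν} ∂_ν S(x(s)) for all s ∈ I. Then η_{μν} (dx^μ/ds)(dx^ν/ds) = 1 along the curve, and x satisfies the pregeodesic equation of the conformally rescaled metric g_{μν} = (M/m₀)² η_{μν}: d²x^λ/ds² + Γ^λ_{μν}(x(s)) (dx^μ/ds)(dx^ν/ds) = ( (dx^κ/ds) ∂_κ ω(x(s)) ) dx^λ/ds for all s, where Γ^λ_{μν} = δ^λ_μ ∂_ν ω + δ^λ_ν ∂_μ ω − η_{μν} η^{λκ} ∂_κ ω are the Christoffel symbols of g; hence the trajectories of the flow are geodesics of g up to reparametrization, as if spacetime carried the non-Euclidean metric g = (M²/m₀²) η. -/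

import Mathlib

noncomputable section

open scoped BigOperators

/-- Partial derivative `∂_μ f` of a real-valued function on `ℝⁿ`. -/
def pd {n : ℕ} (μ : Fin n) (f : (Fin n → ℝ) → ℝ) : (Fin n → ℝ) → ℝ :=
  fun x => fderiv ℝ f x (Pi.single μ 1)

/-- Partial derivative `∂_μ f` of a complex-valued function on `ℝⁿ`. -/
def pdC {n : ℕ} (μ : Fin n) (f : (Fin n → ℝ) → ℂ) : (Fin n → ℝ) → ℂ :=
  fun x => fderiv ℝ f x (Pi.single μ 1)

/-- Christoffel symbols `_gΓ^μ_{νλ}` of the metric `g` (with inverse `ginv`). -/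
def christoffel {n : ℕ} (g ginv : (Fin n → ℝ) → Fin n → Fin n → ℝ)
    (μ ν lam : Fin n) (x : Fin n → ℝ) : ℝ :=
  (1/2) * ∑ κ, ginv x μ κ *
    (pd ν (fun y => g y κ lam) x + pd lam (fun y => g y κ ν) x - pd κ (fun y => g y ν lam) x)

/-- Weylian affine connection `Γ^μ_{νλ}` of the Weylian metric `(g, φ)`:
`Γ^μ_{νλ} = _gΓ^μ_{νλ} + δ^μ_ν φ_λ + δ^μ_λ φ_ν − g_{νλ} φ^μ`. -/
def weylConn {n : ℕ} (g ginv : (Fin n → ℝ) → Fin n → Fin n → ℝ)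
    (φ : (Fin n → ℝ) → Fin n → ℝ) (μ ν lam : Fin n) (x : Fin n → ℝ) : ℝ :=
  christoffel g ginv μ ν lam x
    + (if ν = μ then φ x lam else 0) + (if lam = μ then φ x ν else 0)
    - g x ν lam * ∑ κ, ginv x μ κ * φ x κ

/-- Curvature tensor `R^μ_{νλκ}` of a family of connection coefficients `Γ`. -/
def curvOf {n : ℕ} (Γ : (Fin n → ℝ) → Fin n → Fin n → Fin n → ℝ)
    (μ ν lam κ : Fin n) (x : Fin n → ℝ) : ℝ :=
  pd lam (fun y => Γ y μ ν κ) x - pd κ (fun y => Γ y μ ν lam) x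
    + ∑ σ, Γ x μ lam σ * Γ x σ ν κ - ∑ σ, Γ x μ κ σ * Γ x σ ν lam

/-- Ricci tensor `R_{νκ} = R^μ_{νμκ}`. -/
def ricciOf {n : ℕ} (Γ : (Fin n → ℝ) → Fin n → Fin n → Fin n → ℝ)
    (ν κ : Fin n) (x : Fin n → ℝ) : ℝ :=
  ∑ μ, curvOf Γ μ ν μ κ x

/-- Scalar curvature `R = g^{νκ} R_{νκ}`. -/
def scalarOf {n : ℕ} (ginv : (Fin n → ℝ) → Fin n → Fin n → ℝ)
    (Γ : (Fin n → ℝ) → Fin n → Fin n → Fin n → ℝ) (x : Fin n → ℝ) : ℝ :=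
  ∑ ν, ∑ κ, ginv x ν κ * ricciOf Γ ν κ x

/-- Volume factor `√|det g|`. -/
def volFac {n : ℕ} (g : (Fin n → ℝ) → Fin n → Fin n → ℝ) (x : Fin n → ℝ) : ℝ :=
  Real.sqrt |Matrix.det (Matrix.of (g x))|

/-- Laplace–Beltrami operator `Δ_g f = (1/√|det g|) ∂_μ ( √|det g| g^{μν} ∂_ν f )`. -/
def laplaceBeltrami {n : ℕ} (g ginv : (Fin n → ℝ) → Fin n → Fin n → ℝ)
    (f : (Fin n → ℝ) → ℝ) (x : Fin n → ℝ) : ℝ :=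
  (volFac g x)⁻¹ * ∑ μ, pd μ (fun y => volFac g y * ∑ ν, ginv y μ ν * pd ν f y) x

/-- Minkowski matrix `η = diag(1, −1, −1, −1)`. -/
def etaM : Fin 4 → Fin 4 → ℝ :=
  fun μ ν => if μ = ν then (if μ = 0 then 1 else -1) else 0

/-- The differential applied to a vector is the contraction with the partial derivatives. -/
theorem fderiv_apply_eq_sum_pd {n : ℕ} (f : (Fin n → ℝ) → ℝ) (y w : Fin n → ℝ) :
    fderiv ℝ f y w = ∑ μ, w μ * pd μ f y := by
  have h := (fderiv ℝ f y).toLinearMap.pi_apply_eq_sum_univ w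
  simp only [ContinuousLinearMap.coe_coe, smul_eq_mul] at h
  rw [h]
  refine Finset.sum_congr rfl fun μ _ => ?_
  congr 2
  ext j
  simp [Pi.single_apply, eq_comm]

/-- Chain rule along a curve, in coordinates. -/
theorem hasDerivAt_comp_curve {n : ℕ} {f : (Fin n → ℝ) → ℝ} {x : ℝ → Fin n → ℝ}
    {w : Fin n → ℝ} {s : ℝ} (hf : DifferentiableAt ℝ f (x s))
    (hx : ∀ μ, HasDerivAt (fun t => x t μ) (w μ) s) :
    HasDerivAt (fun t => f (x t)) (∑ μ, w μ * pd μ f (x s)) s := by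
  rw [← fderiv_apply_eq_sum_pd]
  exact hf.hasFDerivAt.comp_hasDerivAt s (hasDerivAt_pi.2 hx)

theorem differentiableAt_pd {n : ℕ} {f : (Fin n → ℝ) → ℝ} {y : Fin n → ℝ}
    (hf : ContDiffAt ℝ 2 f y) (μ : Fin n) : DifferentiableAt ℝ (pd μ f) y :=
  ((hf.fderiv_right (m := 1) (by norm_num)).differentiableAt (by norm_num)).clm_apply
    (differentiableAt_const _)

/-- Equality of mixed partial derivatives. -/
theorem pd_comm {n : ℕ} {f : (Fin n → ℝ) → ℝ} {y : Fin n → ℝ}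
    (hf : ContDiffAt ℝ 2 f y) (μ ν : Fin n) : pd μ (pd ν f) y = pd ν (pd μ f) y := by
  have hd : DifferentiableAt ℝ (fderiv ℝ f) y :=
    (hf.fderiv_right (m := 1) (by norm_num)).differentiableAt (by norm_num)
  have key : ∀ a b : Fin n,
      pd a (pd b f) y = fderiv ℝ (fderiv ℝ f) y (Pi.single a 1) (Pi.single b 1) := by
    intro a b
    have h := hd.hasFDerivAt.clm_apply (hasFDerivAt_const (Pi.single b (1 : ℝ)) y)
    change fderiv ℝ (fun z => fderiv ℝ f z (Pi.single b 1)) y (Pi.single a 1) = _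
    rw [h.fderiv]
    simp
  rw [key, key]
  exact (hf.isSymmSndFDerivAt (by simp)).eq _ _

theorem sum_etaM_mul (a : Fin 4) (w : Fin 4 → ℝ) : ∑ ν, etaM a ν * w ν = etaM a a * w a := by
  refine Fintype.sum_eq_single a fun ν hν => ?_
  simp [etaM, hν.symm]

theorem etaM_diag_sq (a : Fin 4) : etaM a a * etaM a a = 1 := by
  by_cases h : a = 0 <;> simp [etaM, h]

theorem sum_sum_etaM_mul (u w : Fin 4 → ℝ) :
    ∑ μ, ∑ ν, etaM μ ν * u μ * w ν = ∑ μ, etaM μ μ * u μ * w μ := by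
  refine Finset.sum_congr rfl fun μ _ => ?_
  rw [mul_right_comm, ← sum_etaM_mul μ w, Finset.sum_mul]
  exact Finset.sum_congr rfl fun _ _ => mul_right_comm _ _ _

/-- Contraction of the Christoffel symbols of a conformally flat metric with a vector, twice. -/
theorem sum_conformal_christoffel (d w : Fin 4 → ℝ) (lam : Fin 4) :
    ∑ μ, ∑ ν, ((if μ = lam then d ν else 0) + (if ν = lam then d μ else 0)
        - etaM μ ν * ∑ κ, etaM lam κ * d κ) * w μ * w ν
      = 2 * (∑ κ, w κ * d κ) * w lam
        - (∑ μ, ∑ ν, etaM μ ν * w μ * w ν) * (etaM lam lam * d lam) := by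
  rw [sum_etaM_mul]
  simp only [add_mul, sub_mul, Finset.sum_add_distrib, Finset.sum_sub_distrib, ite_mul, zero_mul,
    Finset.sum_ite_eq', Finset.mem_univ, if_true, Finset.sum_mul]
  have h : ∀ μ, ∑ ν, (if μ = lam then d ν * w μ * w ν else 0)
      = if μ = lam then ∑ ν, d ν * w μ * w ν else 0 := by
    intro μ
    split_ifs <;> simp
  simp only [h, Finset.sum_ite_eq', Finset.mem_univ, if_true, two_mul, add_mul, Finset.sum_mul]
  congr 1
  · congr 1 <;> exact Finset.sum_congr rfl fun _ _ => by ring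
  · exact Finset.sum_congr rfl fun _ _ => Finset.sum_congr rfl fun _ _ => by ring

/-- Differentiated Hamilton–Jacobi equation: `η^{μμ} ∂_μS ∂_ν∂_μS = M ∂_νM`. -/
theorem sum_etaM_pd_mul_pd_pd {S M : (Fin 4 → ℝ) → ℝ} {y : Fin 4 → ℝ}
    (hS : ContDiffAt ℝ 2 S y) (hM : DifferentiableAt ℝ M y)
    (hHJ : ∀ᶠ z in nhds y, ∑ μ, ∑ ν, etaM μ ν * pd μ S z * pd ν S z = M z ^ 2) (ν : Fin 4) :
    ∑ μ, etaM μ μ * pd μ S y * pd ν (pd μ S) y = M y * pd ν M y := by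
  have hL : HasFDerivAt (fun z => ∑ μ, etaM μ μ * (pd μ S z) ^ 2) _ y :=
    HasFDerivAt.fun_sum (u := Finset.univ) fun μ _ =>
      ((differentiableAt_pd hS μ).hasFDerivAt.pow 2).const_mul (etaM μ μ)
  have hR := hM.hasFDerivAt.pow 2
  have he : (fun z => ∑ μ, etaM μ μ * (pd μ S z) ^ 2) =ᶠ[nhds y] fun z => M z ^ 2 := by
    filter_upwards [hHJ] with z hz
    rw [← hz, sum_sum_etaM_mul (fun μ => pd μ S z) (fun μ => pd μ S z)]
    exact Finset.sum_congr rfl fun _ _ => by ring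
  have h := DFunLike.congr_fun (hL.unique (hR.congr_of_eventuallyEq he)) (Pi.single ν (1 : ℝ))
  simp only [sum_apply, smul_apply, smul_eq_mul,
    nsmul_eq_mul] at h
  change ∑ μ, etaM μ μ * (_ * pd ν (pd μ S) y) = _ * pd ν M y at h
  have h2 : (2 : ℝ) * ∑ μ, etaM μ μ * pd μ S y * pd ν (pd μ S) y = 2 * (M y * pd ν M y) := by
    rw [Finset.mul_sum]
    calc _ = _ := Finset.sum_congr rfl fun _ _ => by push_cast; ring
      _ = _ := h
      _ = _ := by push_cast; ring
  linarith

/-- De Broglie's geometrization of the quantum Hamilton–Jacobi flow: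
if `η^{μν} ∂_μS ∂_νS = M²` on `U`, `ω = log(M/m₀)`, and a smooth curve `x` satisfies
`dx^μ/ds = M⁻¹ η^{μν} ∂_νS`, then `η_{μν} (dx^μ/ds)(dx^ν/ds) = 1` along the curve and `x`
satisfies the pregeodesic equation of the conformally rescaled metric `g = (M/m₀)² η`:
`d²x^λ/ds² + Γ^λ_{μν} (dx^μ/ds)(dx^ν/ds) = ((dx^κ/ds) ∂_κω) dx^λ/ds`, with
`Γ^λ_{μν} = δ^λ_μ ∂_νω + δ^λ_ν ∂_μω − η_{μν} η^{λκ} ∂_κω`. -/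
theorem de_broglie_geometrization
    (U : Set (Fin 4 → ℝ)) (hU : IsOpen U)
    (S M : (Fin 4 → ℝ) → ℝ)
    (hS : ContDiffOn ℝ (⊤ : ℕ∞) S U) (hM : ContDiffOn ℝ (⊤ : ℕ∞) M U)
    (hMpos : ∀ y ∈ U, 0 < M y)
    (hHJ : ∀ y ∈ U, ∑ μ, ∑ ν, etaM μ ν * pd μ S y * pd ν S y = (M y) ^ 2)
    (m₀ : ℝ) (hm₀ : 0 < m₀)
    (ω : (Fin 4 → ℝ) → ℝ) (hω : ∀ y, ω y = Real.log (M y / m₀))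
    (I : Set ℝ) (hI : IsOpen I)
    (x : ℝ → Fin 4 → ℝ)
    (hxU : ∀ s ∈ I, x s ∈ U)
    (hxsmooth : ∀ μ, ContDiffOn ℝ (⊤ : ℕ∞) (fun t => x t μ) I)
    (v : ℝ → Fin 4 → ℝ)
    (hv : ∀ s μ, v s μ = deriv (fun t => x t μ) s)
    (hflow : ∀ s ∈ I, ∀ μ,
      v s μ = (M (x s))⁻¹ * ∑ ν, etaM μ ν * pd ν S (x s)) :
    (∀ s ∈ I, ∑ μ, ∑ ν, etaM μ ν * v s μ * v s ν = 1)
    ∧ (∀ s ∈ I, ∀ lam : Fin 4,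
        deriv (fun t => v t lam) s
            + ∑ μ, ∑ ν,
                ((if μ = lam then pd ν ω (x s) else 0)
                  + (if ν = lam then pd μ ω (x s) else 0)
                  - etaM μ ν * ∑ κ, etaM lam κ * pd κ ω (x s)) * v s μ * v s ν
          = (∑ κ, v s κ * pd κ ω (x s)) * v s lam) := by
  have hpos : ∀ s ∈ I, 0 < M (x s) := fun s hs => hMpos _ (hxU s hs)
  have hflow' : ∀ s ∈ I, ∀ μ, v s μ = (M (x s))⁻¹ * (etaM μ μ * pd μ S (x s)) :=
    fun s hs μ => by rw [hflow s hs μ, sum_etaM_mul μ fun ν => pd ν S (x s)]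
  have hnorm : ∀ s ∈ I, ∑ μ, ∑ ν, etaM μ ν * v s μ * v s ν = 1 := by
    intro s hs
    have hne := (hpos s hs).ne'
    have h := hHJ _ (hxU s hs)
    rw [sum_sum_etaM_mul (fun μ => pd μ S (x s)) (fun μ => pd μ S (x s))] at h
    rw [sum_sum_etaM_mul]
    calc ∑ μ, etaM μ μ * v s μ * v s μ
        = ((M (x s))⁻¹) ^ 2 * ∑ μ, etaM μ μ * pd μ S (x s) * pd μ S (x s) := by
          rw [Finset.mul_sum]
          refine Finset.sum_congr rfl fun μ _ => ?_
          rw [hflow' s hs μ]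
          linear_combination ((M (x s))⁻¹ ^ 2 * etaM μ μ * pd μ S (x s) ^ 2) * etaM_diag_sq μ
      _ = 1 := by rw [h]; field_simp
  refine ⟨hnorm, fun s hs lam => ?_⟩
  have hUs : U ∈ nhds (x s) := hU.mem_nhds (hxU s hs)
  have hIs : I ∈ nhds s := hI.mem_nhds hs
  have hne := (hpos s hs).ne'
  have hS2 : ContDiffAt ℝ 2 S (x s) := (hS.contDiffAt hUs).of_le (WithTop.coe_le_coe.2 le_top)
  have hMd : DifferentiableAt ℝ M (x s) := (hM.contDiffAt hUs).differentiableAt (by simp)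
  have hx : ∀ μ, HasDerivAt (fun t => x t μ) (v s μ) s := fun μ => by
    rw [hv]
    exact (((hxsmooth μ).contDiffAt hIs).differentiableAt (by simp)).hasDerivAt
  have hMx := hasDerivAt_comp_curve hMd hx
  have hω' : ∀ ν, pd ν ω (x s) = (M (x s))⁻¹ * pd ν M (x s) := by
    intro ν
    have h := (hMd.hasFDerivAt.mul_const m₀⁻¹).log (mul_ne_zero hne (inv_ne_zero hm₀.ne'))
    have hfun : ω = fun y => Real.log (M y * m₀⁻¹) := funext fun y => by
      rw [hω, div_eq_mul_inv]
    unfold pd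
    rw [hfun, h.fderiv]
    simp only [smul_apply, smul_eq_mul]
    field_simp
  have hp : HasDerivAt (fun t => pd lam S (x t)) (pd lam M (x s)) s := by
    convert hasDerivAt_comp_curve (differentiableAt_pd hS2 lam) hx using 1
    have h := sum_etaM_pd_mul_pd_pd hS2 hMd (Filter.eventually_of_mem hUs hHJ) lam
    calc pd lam M (x s) = (M (x s))⁻¹ * (M (x s) * pd lam M (x s)) := by field_simp
      _ = _ := by
        rw [← h, Finset.mul_sum]
        refine Finset.sum_congr rfl fun μ _ => ?_
        rw [hflow' s hs μ, pd_comm hS2 μ lam]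
        ring
  have hacc : deriv (fun t => v t lam) s
      = -(∑ κ, v s κ * pd κ ω (x s)) * v s lam + etaM lam lam * pd lam ω (x s) := by
    have hev : (fun t => v t lam) =ᶠ[nhds s]
        fun t => (M (x t))⁻¹ * (etaM lam lam * pd lam S (x t)) :=
      Filter.eventually_of_mem hIs fun t ht => hflow' t ht lam
    rw [hev.deriv_eq, ((hMx.fun_inv hne).fun_mul (hp.const_mul (etaM lam lam))).deriv]
    have hsum : ∑ κ, v s κ * pd κ ω (x s) = (M (x s))⁻¹ * ∑ κ, v s κ * pd κ M (x s) := by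
      rw [Finset.mul_sum]
      exact Finset.sum_congr rfl fun κ _ => by rw [hω']; ring
    rw [hsum, hω', hflow' s hs lam]
    field_simp
  rw [sum_conformal_christoffel (fun κ => pd κ ω (x s)) (v s) lam, hnorm s hs, hacc]
  ring
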